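/- Lower bound for the squared-norm convergence measure of normalized gradient descent: for every L > 0 there exists an L-smooth function F : ℝ → ℝ bounded below such that for every initial point x₁ > 0, setting Δ₁ = F(x₁) − inf F, every horizon T ≥ 18, and running normalized gradient descent x_{t+1} = x_t − η·F'(x_t)/|F'(x_t)| (i.e. a sign step; steps with F'(x_t) = 0 move by 0) with constant step-size η = √(Δ₁/(L·T)) for T iterations, the iterates satisfy √( (1/T)·∑_{t=1}^T |F'(x_t)|² ) ≥ (2/3)·√(Δ₁·L)·T^{-1/4}. -/

import Mathlib

open Real

/-- Theorem 4: lower bound for the squared-norm convergence measure of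
normalized gradient descent: there is an `L`-smooth function `F : ℝ → ℝ`, bounded below, such
that from any initial point `x₁ > 0`, running sign gradient descent with the tuned step-size
`√(Δ₁/(L·T))` for `T ≥ 18` iterations, the root-mean-square of the gradients is at least
`(2/3)·√(Δ₁·L)·T^{-1/4}`, where `Δ₁ = F(x₁) − inf F`. -/
theorem ngd_squared_measure_lower_bound :
    ∀ L : ℝ, 0 < L →
    ∃ (F : ℝ → ℝ) (F' : ℝ → ℝ),
      -- F is differentiable with derivative F' and is L-smooth
      (∀ x, HasDerivAt F (F' x) x) ∧
      (∀ x y, |F' x - F' y| ≤ L * |x - y|) ∧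
      -- F is bounded below
      BddBelow (Set.range F) ∧
      ∀ x₁ : ℝ, 0 < x₁ →
      ∀ T : ℕ, 18 ≤ T →
      ∀ x : ℕ → ℝ, x 1 = x₁ →
      -- normalized (sign) gradient descent with step-size √(Δ₁/(L·T)),
      -- where Δ₁ = F(x₁) − inf F; a zero gradient gives a zero step
      (∀ t : ℕ, 1 ≤ t →
        x (t + 1) = x t -
          Real.sqrt ((F x₁ - sInf (Set.range F)) / (L * (T : ℝ))) * (F' (x t) / |F' (x t)|)) →
      (2 / 3) * Real.sqrt ((F x₁ - sInf (Set.range F)) * L) / (T : ℝ) ^ ((1 : ℝ) / 4) ≤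
        Real.sqrt ((1 / (T : ℝ)) * ∑ t ∈ Finset.Icc 1 T, (F' (x t)) ^ 2) := by
  intro L hL
  have hinf : sInf (Set.range fun x : ℝ => L / 2 * x ^ 2) = 0 := by
    apply le_antisymm
    · exact csInf_le ⟨0, by rintro _ ⟨y, rfl⟩; positivity⟩ ⟨0, by simp⟩
    · apply Real.sInf_nonneg
      rintro _ ⟨y, rfl⟩
      positivity
  refine ⟨fun x => L / 2 * x ^ 2, fun x => L * x, ?_, ?_, ⟨0, ?_⟩, ?_⟩
  · intro x
    have h := ((hasDerivAt_id x).pow 2).const_mul (L / 2)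
    refine h.congr_deriv ?_
    simp
    ring
  · intro x y
    rw [← mul_sub, abs_mul, abs_of_pos hL]
  · rintro _ ⟨y, rfl⟩
    positivity
  intro x₁ hx₁ T hT x hx1 hstep
  rw [hinf] at *
  simp only [sub_zero] at *
  have hT' : (18 : ℝ) ≤ T := by exact_mod_cast hT
  have hT0 : (0 : ℝ) < T := by linarith
  set η := Real.sqrt (L / 2 * x₁ ^ 2 / (L * (T : ℝ))) with hη
  have hη0 : 0 < η := Real.sqrt_pos.2 (by positivity)
  have hη2 : η ^ 2 * T = x₁ ^ 2 / 2 := by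
    rw [hη, Real.sq_sqrt (by positivity)]
    field_simp
  -- each step moves by at most η
  have habs : ∀ k : ℕ, x₁ - k * η ≤ |x (k + 1)| := by
    intro k
    induction k with
    | zero => simp [hx1, abs_of_pos hx₁]
    | succ k ih =>
      have hs := hstep (k + 1) (by omega)
      have h1 : |η * (L * x (k + 1) / |L * x (k + 1)|)| ≤ η := by
        rw [abs_mul, abs_div, abs_abs, abs_of_pos hη0]
        exact mul_le_of_le_one_right hη0.le (div_self_le_one _)
      have h2 := abs_sub_abs_le_abs_sub (x (k + 1)) (η * (L * x (k + 1) / |L * x (k + 1)|))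
      rw [← hs] at h2
      push_cast
      linarith
  have hsq : ∀ k : ℕ, x₁ ^ 2 - 2 * k * η * x₁ ≤ x (k + 1) ^ 2 := by
    intro k
    have h := habs k
    rw [← sq_abs (x (k + 1))]
    have hk : 0 ≤ (k : ℝ) * η := by positivity
    rcases le_total (k * η) x₁ with h' | h'
    · nlinarith
    · nlinarith [sq_nonneg |x (k + 1)|]
  have hsum : ∀ n : ℕ, n * x₁ ^ 2 - n * (n - 1) * η * x₁ ≤
      ∑ k ∈ Finset.range n, x (k + 1) ^ 2 := by
    intro n
    induction n with
    | zero => simp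
    | succ n ih =>
      rw [Finset.sum_range_succ]
      have := hsq n
      push_cast
      linarith
  obtain ⟨m, hm1, hm2⟩ : ∃ m : ℕ, m * η ≤ x₁ / 2 ∧ x₁ / 2 < (m + 1) * η := by
    refine ⟨⌊x₁ / 2 / η⌋₊, ?_, ?_⟩
    · rw [← le_div_iff₀ hη0]
      exact Nat.floor_le (by positivity)
    · rw [← div_lt_iff₀ hη0]
      exact Nat.lt_floor_add_one _
  have hmT : m + 1 ≤ T := by
    by_contra hc
    have h1 : (T : ℝ) ≤ m := by exact_mod_cast (by omega : T ≤ m)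
    have h2 : T * η ≤ x₁ / 2 := le_trans (by gcongr) hm1
    have h3 : (T * η) ^ 2 ≤ (x₁ / 2) ^ 2 := by gcongr
    have h4 : (T * η) ^ 2 = T * (x₁ ^ 2 / 2) := by rw [← hη2]; ring
    have h5 : 0 < x₁ ^ 2 := by positivity
    nlinarith
  have hS : ∑ t ∈ Finset.Icc 1 T, (L * x t) ^ 2 =
      L ^ 2 * ∑ k ∈ Finset.range T, x (k + 1) ^ 2 := by
    rw [Finset.mul_sum, Finset.range_eq_Ico,
      Finset.sum_Ico_add' (fun t => L ^ 2 * x t ^ 2) 0 T 1]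
    apply Finset.sum_congr
    · ext t
      simp
    · intros
      ring
  have hmono : ∑ k ∈ Finset.range (m + 1), x (k + 1) ^ 2 ≤
      ∑ k ∈ Finset.range T, x (k + 1) ^ 2 :=
    Finset.sum_le_sum_of_subset_of_nonneg (Finset.range_mono hmT) fun _ _ _ => sq_nonneg _
  have hlow : (m + 1) * (x₁ ^ 2 / 2) ≤ ∑ k ∈ Finset.range T, x (k + 1) ^ 2 := by
    refine le_trans ?_ ((hsum (m + 1)).trans hmono)
    push_cast
    have h : (m + 1) * x₁ * (m * η) ≤ (m + 1) * x₁ * (x₁ / 2) := by gcongr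
    linarith
  set S := ∑ k ∈ Finset.range T, x (k + 1) ^ 2 with hSdef
  set r := Real.sqrt (T : ℝ) with hr
  have hr0 : 0 < r := Real.sqrt_pos.2 hT0
  have hr2 : r ^ 2 = T := Real.sq_sqrt hT0.le
  have hrp : ((T : ℝ) ^ ((1 : ℝ) / 4)) ^ 2 = r := by
    rw [← Real.rpow_natCast, ← Real.rpow_mul hT0.le, hr, Real.sqrt_eq_rpow]
    norm_num
  have hrη : r * η ≤ x₁ := by
    refine (sq_le_sq₀ (by positivity) hx₁.le).1 ?_
    rw [mul_pow, hr2]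
    nlinarith [sq_nonneg x₁]
  have hmr : r ≤ 2 * (m + 1) := by
    have : r * η ≤ (2 * (m + 1)) * η := by linarith
    exact le_of_mul_le_mul_right this hη0
  rw [hS]
  apply Real.le_sqrt_of_sq_le
  rw [div_pow, mul_pow, hrp, Real.sq_sqrt (by positivity), ← hr2, div_le_iff₀ hr0]
  have hSr : r * (x₁ ^ 2 / 4) ≤ S := by
    refine le_trans ?_ hlow
    nlinarith [sq_nonneg x₁]
  have e : 1 / r ^ 2 * (L ^ 2 * S) * r = L ^ 2 * (S / r) := by
    field_simp
  rw [e]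
  have h6 : x₁ ^ 2 / 4 ≤ S / r := by
    rw [le_div_iff₀ hr0]
    linarith
  have h7 : L ^ 2 * (x₁ ^ 2 / 4) ≤ L ^ 2 * (S / r) := by gcongr
  have h8 : 0 ≤ L ^ 2 * x₁ ^ 2 := by positivity
  linarith
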